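/- arXiv:1911.08102 — 2 statements merged into one kernel-verified Lean document; each statement's English description precedes it below -/
import Mathlib

section
/- For n ≥ 1, let AD_n (the Aztec diamond of rank n) be the simple graph whose vertex set is {(x,y) ∈ ℤ² : |2x−1| + |2y−1| ≤ 2n} and in which two vertices are adjacent if and only if they differ by exactly 1 in exactly one coordinate. Then the number of channels of AD_n is exactly 2^{2n}; consequently 2ⁿ divides the number of perfect matchings of AD_n. -/
/-- The number of perfect matchings of a graph `G`. -/
noncomputable def matchCount {V : Type*} (G : SimpleGraph V) : ℕ :=
  Nat.card {M : G.Subgraph // M.IsPerfectMatching}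

/-- A channel of `G` is a set `C` of vertices such that every vertex of `G`
has an even number of neighbors in `C`. -/
def IsChannel {V : Type*} (G : SimpleGraph V) (C : Set V) : Prop :=
  ∀ v : V, Even {w | w ∈ C ∧ G.Adj v w}.ncard

/-- The Aztec diamond of rank `n`: the induced subgraph of the square lattice `ℤ²` on the
vertex set `{(x,y) : |2x−1| + |2y−1| ≤ 2n}`. -/
def aztecDiamond (n : ℕ) :
    SimpleGraph {p : ℤ × ℤ // |2 * p.1 - 1| + |2 * p.2 - 1| ≤ 2 * (n : ℤ)} :=
  SimpleGraph.fromRel (fun v w =>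
    (v.val.1 = w.val.1 ∧ v.val.2 + 1 = w.val.2) ∨
      (v.val.2 = w.val.2 ∧ v.val.1 + 1 = w.val.1))

/-- Perfect matchings of `G` correspond to maps sending each vertex to its partner. -/
noncomputable def perfectMatchingEquiv {V : Type*} (G : SimpleGraph V) :
    {M : G.Subgraph // M.IsPerfectMatching} ≃
      {f : V → V // ∀ v, G.Adj v (f v) ∧ f (f v) = v} where
  toFun M :=
    have h := SimpleGraph.Subgraph.isPerfectMatching_iff.1 M.2
    ⟨fun v => (h v).choose, fun v =>
      ⟨M.1.adj_sub (h v).choose_spec.1,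
        ((h _).choose_spec.2 v (h v).choose_spec.1.symm).symm⟩⟩
  invFun f :=
    ⟨{ verts := Set.univ
       Adj := fun v w => f.1 v = w
       adj_sub := by rintro v w rfl; exact (f.2 v).1
       edge_vert := fun _ => Set.mem_univ _
       symm := ⟨by rintro v w rfl; exact (f.2 v).2⟩ },
      SimpleGraph.Subgraph.isPerfectMatching_iff.2 fun v => ⟨f.1 v, rfl, fun _ h => Eq.symm h⟩⟩
  left_inv M := by
    have h := SimpleGraph.Subgraph.isPerfectMatching_iff.1 M.2
    apply Subtype.ext
    apply SimpleGraph.Subgraph.ext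
    · exact (Set.eq_univ_of_forall M.2.2).symm
    · funext v w
      refine propext ⟨?_, fun hw => ((h v).choose_spec.2 w hw).symm⟩
      rintro rfl
      exact (h v).choose_spec.1
  right_inv f := by
    have h (v : V) : ∃! w, f.1 v = w := ⟨f.1 v, rfl, fun _ h => h.symm⟩
    exact Subtype.ext (funext fun v => (h v).choose_spec.1.symm)

/-- A decomposition of the edges of `G` into four-cycles, the cells, which are arranged in rows.
The cell through an edge `v w` has vertices `v`, `w`, `opp w v`, `opp v w` in cyclic order up to
reversal, and it lies in the row `row v w`. -/
structure CellDecomposition {V : Type*} (G : SimpleGraph V) (ι : Type*) where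
  /-- The vertex opposite to `w` in the cell through the edge `v w`. -/
  opp : V → V → V
  /-- The row of the cell through the edge `v w`. -/
  row : V → V → ι
  adj_opp : ∀ {v w}, G.Adj v w → G.Adj v (opp v w)
  opp_opp : ∀ {v w}, G.Adj v w → opp v (opp v w) = w
  opp_ne : ∀ {v w}, G.Adj v w → opp v w ≠ w
  opp_left : ∀ {v w}, G.Adj v w → opp (opp v w) v = opp w v
  row_comm : ∀ {v w}, G.Adj v w → row v w = row w v
  row_opp : ∀ {v w}, G.Adj v w → row v (opp v w) = row v w

namespace CellDecomposition

variable {V ι : Type*} {G : SimpleGraph V} (D : CellDecomposition G ι)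

theorem opp_opp_opp {v w : V} (h : G.Adj v w) : D.opp (D.opp w v) (D.opp v w) = w := by
  rw [← D.opp_left h.symm, D.opp_opp (D.adj_opp h.symm).symm]

theorem row_opp_opp {v w : V} (h : G.Adj v w) :
    D.row (D.opp w v) (D.opp v w) = D.row v w := by
  rw [← D.opp_left h.symm, D.row_opp (D.adj_opp h.symm).symm,
    D.row_comm (D.adj_opp h.symm).symm, D.row_opp h.symm, D.row_comm h]

/-- The cell containing the edge `v (f v)` has its opposite edge in the matching `f` too. -/
def Doubled (f : V → V) (v : V) : Prop := f (D.opp (f v) v) = D.opp v (f v)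

open Classical in
/-- Flip all doubly covered cells of the matching `f` in the rows where `s` equals `1`. -/
noncomputable def flip (s : ι → ZMod 2) (f : V → V) (v : V) : V :=
  if s (D.row v (f v)) = 1 ∧ D.Doubled f v then D.opp v (f v) else f v

theorem flip_zero (f : V → V) (v : V) : D.flip 0 f v = f v :=
  if_neg fun h => zero_ne_one h.1

theorem doubled_opp {f : V → V} (hf : ∀ v, G.Adj v (f v) ∧ f (f v) = v)
    {v : V} (h : D.Doubled f v) : D.Doubled f (D.opp (f v) v) := by
  unfold Doubled at *
  have := D.opp_opp_opp (hf v).1.symm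
  rw [h, this, D.opp_opp_opp (hf v).1]

theorem doubled_apply {f : V → V} (hf : ∀ v, G.Adj v (f v) ∧ f (f v) = v)
    {v : V} : D.Doubled f (f v) ↔ D.Doubled f v := by
  unfold Doubled
  rw [(hf v).2]
  constructor
  · intro h; rw [← h, (hf _).2]
  · intro h; rw [← h, (hf _).2]

theorem flip_isMatching {f : V → V} (hf : ∀ v, G.Adj v (f v) ∧ f (f v) = v)
    (s : ι → ZMod 2) (v : V) :
    G.Adj v (D.flip s f v) ∧ D.flip s f (D.flip s f v) = v := by
  have hv := (hf v).1
  by_cases h : s (D.row v (f v)) = 1 ∧ D.Doubled f v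
  · have e : D.flip s f v = D.opp v (f v) := if_pos h
    have e' : D.opp v (f v) = f (D.opp (f v) v) := h.2.symm
    have d : D.Doubled f (D.opp v (f v)) := by
      rw [e', D.doubled_apply hf]; exact D.doubled_opp hf h.2
    have e2 : f (D.opp v (f v)) = D.opp (f v) v := by rw [e', (hf _).2]
    refine ⟨e ▸ D.adj_opp hv, ?_⟩
    rw [e, flip, e2, if_pos, D.opp_opp_opp hv.symm]
    refine ⟨?_, d⟩
    rw [D.row_opp_opp hv.symm, ← D.row_comm hv]
    exact h.1
  · have e : D.flip s f v = f v := if_neg h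
    refine ⟨e ▸ hv, ?_⟩
    rw [e, flip, if_neg, (hf v).2]
    rwa [(hf v).2, D.doubled_apply hf, ← D.row_comm hv]

theorem row_flip {f : V → V} (hf : ∀ v, G.Adj v (f v) ∧ f (f v) = v)
    (s : ι → ZMod 2) (v : V) : D.row v (D.flip s f v) = D.row v (f v) := by
  unfold flip
  split_ifs
  · exact D.row_opp (hf v).1
  · rfl

theorem opp_flip {f : V → V} (hf : ∀ v, G.Adj v (f v) ∧ f (f v) = v)
    (s : ι → ZMod 2) (v : V) : D.opp (D.flip s f v) v = D.opp (f v) v := by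
  unfold flip
  split_ifs
  · exact D.opp_left (hf v).1
  · rfl

theorem flip_opp {f : V → V} (hf : ∀ v, G.Adj v (f v) ∧ f (f v) = v)
    (s : ι → ZMod 2) {v : V} (h : D.Doubled f v) :
    D.flip s f (D.opp (f v) v) = D.opp v (D.flip s f v) := by
  have hv := (hf v).1
  have h' : f (D.opp (f v) v) = D.opp v (f v) := h
  have d := D.doubled_opp hf h
  unfold flip
  rw [h', D.row_opp_opp hv]
  by_cases hs : s (D.row v (f v)) = 1
  · rw [if_pos ⟨hs, d⟩, if_pos ⟨hs, h⟩, D.opp_opp_opp hv, D.opp_opp hv]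
  · rw [if_neg (fun H => hs H.1), if_neg (fun H => hs H.1)]

theorem doubled_flip {f : V → V} (hf : ∀ v, G.Adj v (f v) ∧ f (f v) = v)
    (s : ι → ZMod 2) (v : V) : D.Doubled (D.flip s f) v ↔ D.Doubled f v := by
  have hv := (hf v).1
  constructor
  · intro h
    by_contra hd
    have e : D.flip s f v = f v := if_neg fun H => hd H.2
    unfold Doubled at h
    rw [e] at h
    by_cases h' : s (D.row (D.opp (f v) v) (f (D.opp (f v) v))) = 1 ∧
        D.Doubled f (D.opp (f v) v)
    · rw [flip, if_pos h'] at h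
      have h2 := congrArg (D.opp (D.opp (f v) v)) h
      rw [D.opp_opp (hf _).1, D.opp_opp_opp hv] at h2
      have h3 := congrArg f h2
      rw [(hf _).2, (hf _).2] at h3
      exact D.opp_ne hv.symm h3
    · rw [flip, if_neg h'] at h
      exact hd h
  · intro h
    unfold Doubled
    rw [D.opp_flip hf, D.flip_opp hf s h]

theorem flip_add {f : V → V} (hf : ∀ v, G.Adj v (f v) ∧ f (f v) = v)
    (s t : ι → ZMod 2) (v : V) :
    D.flip (s + t) f v = D.flip s (D.flip t f) v := by
  have hadd : ∀ a b : ZMod 2, a + b = 1 ↔ ¬(a = 1 ↔ b = 1) := by decide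
  conv_rhs => rw [flip, D.doubled_flip hf, D.row_flip hf]
  have key : (s + t) (D.row v (f v)) = 1 ∧ D.Doubled f v ↔
      ¬(s (D.row v (f v)) = 1 ∧ D.Doubled f v ↔ t (D.row v (f v)) = 1 ∧ D.Doubled f v) := by
    rw [Pi.add_apply, hadd]
    tauto
  unfold flip
  by_cases hs : s (D.row v (f v)) = 1 ∧ D.Doubled f v <;>
    by_cases ht : t (D.row v (f v)) = 1 ∧ D.Doubled f v
  · rw [if_neg (by tauto), if_pos hs, if_pos ht, D.opp_opp (hf v).1]
  · rw [if_pos (by tauto), if_pos hs, if_neg ht]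
  · rw [if_pos (by tauto), if_neg hs, if_pos ht]
  · rw [if_neg (by tauto), if_neg hs, if_neg ht]

/-- Flipping rows is an action of `ι → ZMod 2` on the perfect matchings of `G`. -/
noncomputable abbrev flipAction :
    AddAction (ι → ZMod 2) {f : V → V // ∀ v, G.Adj v (f v) ∧ f (f v) = v} where
  vadd s f := ⟨D.flip s f.1, D.flip_isMatching f.2 s⟩
  zero_vadd f := Subtype.ext (funext fun v => D.flip_zero f.1 v)
  add_vadd s t f := Subtype.ext (funext fun v => D.flip_add f.2 s t v)

/-- If every perfect matching covers some cell of each row doubly, then the number of perfect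
matchings is divisible by `2` to the power of the number of rows. -/
theorem two_pow_dvd_matchCount [Fintype ι]
    (h : ∀ f : V → V, (∀ v, G.Adj v (f v) ∧ f (f v) = v) →
      ∀ i, ∃ v, D.row v (f v) = i ∧ D.Doubled f v) :
    2 ^ Fintype.card ι ∣ matchCount G := by
  let := D.flipAction
  have hstab : ∀ f : {f : V → V // ∀ v, G.Adj v (f v) ∧ f (f v) = v},
      AddAction.stabilizer (ι → ZMod 2) f = ⊥ := by
    intro f
    rw [eq_bot_iff]
    intro s hs
    rw [AddAction.mem_stabilizer_iff] at hs
    rw [AddSubgroup.mem_bot]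
    funext i
    obtain ⟨v, rfl, hd⟩ := h f.1 f.2 i
    have hz : ∀ a : ZMod 2, a ≠ 1 → a = 0 := by decide
    refine hz _ fun h1 => ?_
    have h2 : D.flip s f.1 v = f.1 v := congrFun (congrArg Subtype.val hs) v
    rw [flip, if_pos ⟨h1, hd⟩] at h2
    exact D.opp_ne (f.2 v).1 h2
  rw [matchCount, Nat.card_congr (perfectMatchingEquiv G),
    Nat.card_congr (AddAction.selfEquivOrbitsQuotientProd hstab), Nat.card_prod]
  have hcard : Nat.card (ι → ZMod 2) = 2 ^ Fintype.card ι := by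
    rw [Nat.card_fun, Nat.card_zmod, Nat.card_eq_fintype_card]
  rw [hcard]
  exact dvd_mul_left _ _

end CellDecomposition

/-- The vertices of the Aztec diamond of rank `n`. -/
abbrev AztecVertex (n : ℕ) : Type :=
  {p : ℤ × ℤ // |2 * p.1 - 1| + |2 * p.2 - 1| ≤ 2 * (n : ℤ)}

theorem aztec_bound_iff {n : ℕ} {x y : ℤ} :
    |2 * x - 1| + |2 * y - 1| ≤ 2 * (n : ℤ) ↔
      1 - n ≤ x + y ∧ x + y ≤ 1 + n ∧ -n ≤ x - y ∧ x - y ≤ n := by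
  rcases abs_cases (2 * x - 1) with h | h <;> rcases abs_cases (2 * y - 1) with h' | h' <;> omega

theorem aztecDiamond_adj {n : ℕ} {v w : AztecVertex n} :
    (aztecDiamond n).Adj v w ↔
      (v.1.1 = w.1.1 ∧ (v.1.2 + 1 = w.1.2 ∨ w.1.2 + 1 = v.1.2)) ∨
      (v.1.2 = w.1.2 ∧ (v.1.1 + 1 = w.1.1 ∨ w.1.1 + 1 = v.1.1)) := by
  rw [aztecDiamond, SimpleGraph.fromRel_adj, Ne, Subtype.ext_iff, Prod.ext_iff]
  omega

/-- The reflection of `w` in the centre of the cell through the edge `v w`. -/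
def aztecOpp (n : ℕ) (v w : AztecVertex n) : ℤ × ℤ :=
  if (v.1.1 - v.1.2 + n) % 2 = 1 then
    (v.1.1 + (w.1.2 - v.1.2), v.1.2 + (w.1.1 - v.1.1))
  else (v.1.1 - (w.1.2 - v.1.2), v.1.2 - (w.1.1 - v.1.1))

theorem aztecOpp_mem {n : ℕ} {v w : AztecVertex n} (h : (aztecDiamond n).Adj v w) :
    |2 * (aztecOpp n v w).1 - 1| + |2 * (aztecOpp n v w).2 - 1| ≤ 2 * (n : ℤ) := by
  rw [aztecDiamond_adj] at h
  have hv := aztec_bound_iff.1 v.2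
  have hw := aztec_bound_iff.1 w.2
  rw [aztec_bound_iff, aztecOpp]
  split_ifs <;> dsimp only <;> omega

theorem aztecDiamond_adj_opp {n : ℕ} {v w : AztecVertex n} (h : (aztecDiamond n).Adj v w) :
    (aztecDiamond n).Adj v ⟨aztecOpp n v w, aztecOpp_mem h⟩ := by
  rw [aztecDiamond_adj] at h ⊢
  dsimp only [aztecOpp]
  split_ifs <;> dsimp only <;> omega

open Classical in
/-- The decomposition of the Aztec diamond into `n` diagonal rows of `n` cells each. -/
noncomputable def aztecCells (n : ℕ) [NeZero n] :
    CellDecomposition (aztecDiamond n) (Fin n) where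
  opp v w := if h : (aztecDiamond n).Adj v w then ⟨aztecOpp n v w, aztecOpp_mem h⟩ else v
  row v w := Fin.ofNat n (((if (v.1.1 - v.1.2 + n) % 2 = 1 then v.1.1 - v.1.2
    else w.1.1 - w.1.2) + n) / 2).toNat
  adj_opp := by
    intro v w h
    rw [dif_pos h]
    exact aztecDiamond_adj_opp h
  opp_opp := by
    intro v w h
    rw [dif_pos h, dif_pos (aztecDiamond_adj_opp h), Subtype.ext_iff, Prod.ext_iff]
    dsimp only [aztecOpp]
    split_ifs <;> dsimp only <;> omega
  opp_ne := by
    intro v w h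
    rw [dif_pos h, Ne, Subtype.ext_iff, Prod.ext_iff]
    rw [aztecDiamond_adj] at h
    dsimp only [aztecOpp]
    split_ifs <;> dsimp only <;> omega
  opp_left := by
    intro v w h
    rw [dif_pos h, dif_pos h.symm, dif_pos (aztecDiamond_adj_opp h).symm, Subtype.ext_iff,
      Prod.ext_iff]
    rw [aztecDiamond_adj] at h
    dsimp only [aztecOpp]
    split_ifs <;> dsimp only at * <;> omega
  row_comm := by
    intro v w h
    rw [aztecDiamond_adj] at h
    congr 3
    split_ifs <;> omega
  row_opp := by
    intro v w h
    rw [dif_pos h]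
    rw [aztecDiamond_adj] at h
    congr 3
    dsimp only [aztecOpp]
    split_ifs <;> dsimp only
    omega

theorem aztecCells_opp {n : ℕ} [NeZero n] {v w : AztecVertex n} (h : (aztecDiamond n).Adj v w) :
    ((aztecCells n).opp v w).1 = aztecOpp n v w := by
  simp only [aztecCells, dif_pos h]

/-- Two disjoint edges in the same cell are opposite to each other. -/
theorem aztecCells_opp_eq {n : ℕ} [NeZero n] {v w v' w' : AztecVertex n}
    (h : (aztecDiamond n).Adj v w) (h' : (aztecDiamond n).Adj v' w')
    (hodd : (v.1.1 - v.1.2 + n) % 2 = 1) (hv : v.1.1 - v.1.2 = v'.1.1 - v'.1.2)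
    (hw : w.1.1 + w.1.2 = w'.1.1 + w'.1.2) (hvv : v ≠ v') (hww : w ≠ w') :
    (aztecCells n).opp w v = v' ∧ (aztecCells n).opp v w = w' := by
  rw [Subtype.ext_iff, Subtype.ext_iff, aztecCells_opp h, aztecCells_opp h.symm]
  rw [Ne, Subtype.ext_iff] at hvv hww
  rw [aztecDiamond_adj] at h h'
  obtain ⟨⟨a, b⟩, _⟩ := v
  obtain ⟨⟨c, d⟩, _⟩ := w
  obtain ⟨⟨a', b'⟩, _⟩ := v'
  obtain ⟨⟨c', d'⟩, _⟩ := w'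
  simp only [Prod.mk.injEq] at hvv hww
  dsimp only [aztecOpp] at h h' hodd hv hw ⊢
  rw [if_pos hodd, if_neg (by omega), Prod.mk.injEq, Prod.mk.injEq]
  have h1 : a + b ≠ a' + b' := by omega
  have h2 : c - d ≠ c' - d' := by omega
  clear hvv hww
  rcases h with ⟨h, k | k⟩ | ⟨h, k | k⟩ <;> rcases h' with ⟨h', k' | k'⟩ | ⟨h', k' | k'⟩ <;> omega

/-- A row of `n` cells contains `n + 1` vertices all of whose edges lie in that row, so every
perfect matching covers one of its cells doubly. -/
theorem aztecCells_exists_doubled (n : ℕ) [NeZero n] (f : AztecVertex n → AztecVertex n)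
    (hf : ∀ v, (aztecDiamond n).Adj v (f v) ∧ f (f v) = v) (i : Fin n) :
    ∃ v, (aztecCells n).row v (f v) = i ∧ (aztecCells n).Doubled f v := by
  have hi := i.2
  let P : Fin (n + 1) → AztecVertex n := fun j =>
    ⟨((j : ℤ) + i + 1 - n, (j : ℤ) - i), aztec_bound_iff.2 (by have := j.2; omega)⟩
  have hP : ∀ j, (P j).1.1 = (j : ℤ) + i + 1 - n ∧ (P j).1.2 = (j : ℤ) - i :=
    fun j => ⟨rfl, rfl⟩
  clear_value P
  obtain ⟨j, -, k, -, hjk, hcell⟩ := Finset.exists_ne_map_eq_of_card_lt_of_maps_to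
    (s := Finset.univ) (t := Finset.Ico (0 : ℤ) n)
    (f := fun j => ((f (P j)).1.1 + (f (P j)).1.2 + n - 2) / 2) (by simp) (by
      intro j _
      have h := aztecDiamond_adj.1 (hf (P j)).1
      have hb := aztec_bound_iff.1 (f (P j)).2
      have := hP j
      simp only [Finset.coe_Ico, Set.mem_Ico]
      omega)
  have hPj := hP j
  have hPk := hP k
  have hne : P j ≠ P k := by
    intro h
    rw [h] at hPj
    exact hjk (Fin.ext (by omega))
  have hsum : (f (P j)).1.1 + (f (P j)).1.2 = (f (P k)).1.1 + (f (P k)).1.2 := by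
    have hj := aztecDiamond_adj.1 (hf (P j)).1
    have hk := aztecDiamond_adj.1 (hf (P k)).1
    omega
  have hodd : ((P j).1.1 - (P j).1.2 + n) % 2 = 1 := by omega
  obtain ⟨h1, h2⟩ := aztecCells_opp_eq (hf (P j)).1 (hf (P k)).1 hodd (by omega) hsum hne
    fun h => hne (by rw [← (hf (P j)).2, h, (hf (P k)).2])
  refine ⟨P j, ?_, by rw [CellDecomposition.Doubled, h1, h2]⟩
  have hrow : (((P j).1.1 - (P j).1.2 + n) / 2).toNat = i := by omega
  apply Fin.ext
  simp only [aztecCells, if_pos hodd, hrow, Fin.ofNat_eq_cast, Fin.cast_val_eq_self]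

open Classical in
/-- The indicator function of a set of vertices of the Aztec diamond, on all of `ℤ × ℤ`. -/
noncomputable def aztecIndicator {n : ℕ} (C : Set (AztecVertex n)) (x y : ℤ) : ℕ :=
  if (x, y) ∈ Subtype.val '' C then 1 else 0

theorem aztecIndicator_le_one {n : ℕ} (C : Set (AztecVertex n)) (x y : ℤ) :
    aztecIndicator C x y ≤ 1 := by
  unfold aztecIndicator
  split_ifs <;> omega

theorem aztecIndicator_eq_zero {n : ℕ} (C : Set (AztecVertex n)) {x y : ℤ}
    (h : ¬(1 - n ≤ x + y ∧ x + y ≤ 1 + n ∧ -n ≤ x - y ∧ x - y ≤ n)) :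
    aztecIndicator C x y = 0 := by
  refine if_neg ?_
  rintro ⟨v, -, hv⟩
  have := v.2
  rw [hv] at this
  exact h (aztec_bound_iff.1 this)

theorem aztecIndicator_eq_one_iff {n : ℕ} (C : Set (AztecVertex n)) (v : AztecVertex n) :
    aztecIndicator C v.1.1 v.1.2 = 1 ↔ v ∈ C := by
  simp [aztecIndicator, v.2]

theorem ncard_neighbors_eq {n : ℕ} (C : Set (AztecVertex n)) (v : AztecVertex n) :
    {w | w ∈ C ∧ (aztecDiamond n).Adj v w}.ncard =
      aztecIndicator C (v.1.1 + 1) v.1.2 + aztecIndicator C (v.1.1 - 1) v.1.2 +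
        aztecIndicator C v.1.1 (v.1.2 + 1) + aztecIndicator C v.1.1 (v.1.2 - 1) := by
  classical
  obtain ⟨⟨x, y⟩, hv⟩ := v
  let s : Finset (ℤ × ℤ) := {(x + 1, y), (x - 1, y), (x, y + 1), (x, y - 1)}
  have himage : Subtype.val '' {w | w ∈ C ∧ (aztecDiamond n).Adj ⟨(x, y), hv⟩ w} =
      (s.filter (· ∈ Subtype.val '' C) : Finset (ℤ × ℤ)) := by
    ext ⟨a, b⟩
    simp only [Set.mem_image, Set.mem_ofPred_eq, aztecDiamond_adj, Finset.coe_filter, s,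
      Finset.mem_insert, Finset.mem_singleton, Prod.mk.injEq]
    constructor
    · rintro ⟨w, ⟨hw, h⟩, hab⟩
      rw [hab] at h
      exact ⟨by omega, w, hw, hab⟩
    · rintro ⟨h, w, hw, hab⟩
      refine ⟨w, ⟨hw, ?_⟩, hab⟩
      rw [hab]
      dsimp only
      omega
  rw [← Set.ncard_image_of_injective _ Subtype.val_injective, himage, Set.ncard_coe_finset,
    Finset.card_filter]
  simp only [s]
  rw [Finset.sum_insert (by simp; omega), Finset.sum_insert (by simp),
    Finset.sum_insert (by simp; omega), Finset.sum_singleton, ← add_assoc, ← add_assoc]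
  rfl

theorem isChannel_aztecDiamond_iff {n : ℕ} (C : Set (AztecVertex n)) :
    IsChannel (aztecDiamond n) C ↔ ∀ x y : ℤ,
      1 - n ≤ x + y ∧ x + y ≤ 1 + n ∧ -n ≤ x - y ∧ x - y ≤ n →
      Even (aztecIndicator C (x + 1) y + aztecIndicator C (x - 1) y +
        aztecIndicator C x (y + 1) + aztecIndicator C x (y - 1)) := by
  simp only [IsChannel, ncard_neighbors_eq]
  exact ⟨fun h x y hxy => h ⟨(x, y), aztec_bound_iff.2 hxy⟩,
    fun h v => h _ _ (aztec_bound_iff.1 v.2)⟩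

/-- A `0`-`1` array on the points with even first and odd second coordinate that satisfies the
channel condition at the points with odd first and even second coordinate is constant on rows. -/
theorem eq_of_even_sum {n : ℕ} {c : ℤ → ℤ → ℕ} (hle : ∀ a b, c a b ≤ 1)
    (hneg : ∀ a, c a (-1) = 0)
    (h : ∀ i j : ℕ, i < n → j < n → Even (c (2 * j + 2) (2 * i + 1) + c (2 * j) (2 * i - 1) +
      c (2 * j + 2) (2 * i - 1) + c (2 * j) (2 * i + 1)))
    {i j : ℕ} (hi : i < n) (hj : j ≤ n) : c (2 * j) (2 * i + 1) = c 0 (2 * i + 1) := by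
  have step : ∀ i < n, ∀ j < n, c (2 * (j : ℕ) + 2) (2 * (i : ℕ) + 1) = c (2 * j) (2 * i + 1) := by
    intro i
    induction i with
    | zero =>
      intro hi j hj
      have h1 := h 0 j hi hj
      have h2 := hle (2 * j) 1
      have h3 := hle (2 * j + 2) 1
      simp only [Nat.cast_zero, mul_zero, zero_add, zero_sub, hneg, add_zero] at h1 ⊢
      rw [Nat.even_iff] at h1
      omega
    | succ i ih =>
      intro hi j hj
      have h1 := h (i + 1) j hi hj
      have h2 := hle (2 * j) (2 * (i + 1 : ℕ) + 1)
      have h3 := hle (2 * j + 2) (2 * (i + 1 : ℕ) + 1)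
      have h4 := ih (by omega) j hj
      rw [show 2 * ((i + 1 : ℕ) : ℤ) - 1 = 2 * i + 1 by push_cast; ring, Nat.even_iff] at h1
      omega
  induction j with
  | zero => simp
  | succ j ih =>
    rw [← ih (by omega), ← step i hi j (by omega)]
    push_cast
    ring_nf

/-- The channel that is constant on the rows of each of the two colour classes of vertices, with
the rows of one class prescribed by `S` and those of the other one by `T`. -/
def channelOfRows (n : ℕ) (S T : Set (Fin n)) : Set (AztecVertex n) :=
  {v | (∃ i ∈ S, v.1.1 - v.1.2 + n = 2 * (i : ℤ) + 1) ∨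
    ∃ i ∈ T, v.1.1 + v.1.2 + n = 2 * (i : ℤ) + 2}

theorem aztecIndicator_channelOfRows {n : ℕ} (S T : Set (Fin n)) {x y x' y' : ℤ}
    (h : ((x - y + n) % 2 = 1 ∧ x - y = x' - y' ∧
        1 - n ≤ x + y ∧ x + y ≤ 1 + n ∧ 1 - n ≤ x' + y' ∧ x' + y' ≤ 1 + n) ∨
      ((x + y + n) % 2 = 0 ∧ x + y = x' + y' ∧
        -n ≤ x - y ∧ x - y ≤ n ∧ -n ≤ x' - y' ∧ x' - y' ≤ n)) :
    aztecIndicator (channelOfRows n S T) x y = aztecIndicator (channelOfRows n S T) x' y' := by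
  unfold aztecIndicator
  congr 1
  simp only [Set.mem_image, Subtype.exists, exists_and_right, exists_eq_right, channelOfRows,
    Set.mem_ofPred_eq, aztec_bound_iff, exists_prop, eq_iff_iff]
  rcases h with ⟨h0, h, h'⟩ | ⟨h0, h, h'⟩
  · have hT (a b : ℤ) (hab : x - y = a - b) :
        ¬∃ i ∈ T, a + b + n = 2 * (i : ℤ) + 2 := by
      rintro ⟨i, -, hi⟩
      omega
    simp only [hT x y rfl, hT x' y' h, ← h]
    constructor <;> rintro ⟨hb, H⟩ <;> exact ⟨by omega, H⟩
  · have hS (a b : ℤ) (hab : x + y = a + b) :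
        ¬∃ i ∈ S, a - b + n = 2 * (i : ℤ) + 1 := by
      rintro ⟨i, -, hi⟩
      omega
    simp only [hS x y rfl, hS x' y' h, ← h]
    constructor <;> rintro ⟨hb, H⟩ <;> exact ⟨by omega, H⟩

theorem isChannel_channelOfRows {n : ℕ} (S T : Set (Fin n)) :
    IsChannel (aztecDiamond n) (channelOfRows n S T) := by
  rw [isChannel_aztecDiamond_iff]
  intro x y h
  rcases Int.emod_two_eq_zero_or_one (x - y + n) with h0 | h1
  · rw [aztecIndicator_channelOfRows S T (x := x + 1) (x' := x) (y' := y - 1) (by omega),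
      aztecIndicator_channelOfRows S T (x := x - 1) (x' := x) (y' := y + 1) (by omega)]
    rw [Nat.even_iff]
    omega
  · rw [aztecIndicator_channelOfRows S T (x := x + 1) (x' := x) (y' := y + 1) (by omega),
      aztecIndicator_channelOfRows S T (x := x - 1) (x' := x) (y' := y - 1) (by omega)]
    rw [Nat.even_iff]
    omega

/-- The first vertex of a row in the first colour class. -/
def rowStart {n : ℕ} (i : Fin n) : AztecVertex n :=
  ⟨((i : ℤ) + 1 - n, -(i : ℤ)), aztec_bound_iff.2 (by omega)⟩

/-- The first vertex of a row in the second colour class. -/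
def colStart {n : ℕ} (i : Fin n) : AztecVertex n :=
  ⟨((i : ℤ) + 1 - n, (i : ℤ) + 1), aztec_bound_iff.2 (by omega)⟩

theorem IsChannel.mem_iff_rowStart_mem {n : ℕ} {C : Set (AztecVertex n)}
    (hC : IsChannel (aztecDiamond n) C) {v : AztecVertex n} {i : Fin n}
    (hi : v.1.1 - v.1.2 + n = 2 * (i : ℤ) + 1) : v ∈ C ↔ rowStart i ∈ C := by
  rw [isChannel_aztecDiamond_iff] at hC
  have hv := aztec_bound_iff.1 v.2
  have key := eq_of_even_sum (n := n) (i := i) (j := ((v.1.1 + v.1.2 + n - 1) / 2).toNat)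
    (c := fun a b => aztecIndicator C ((a + b + 1) / 2 - n) ((a - b + 1) / 2))
    (fun a b => aztecIndicator_le_one C _ _)
    (fun a => aztecIndicator_eq_zero C (by omega))
    (fun i j hi hj => by
      convert hC (j + i + 1 - n) (j - i + 1) (by omega) using 5 <;> omega)
    i.2 (by omega)
  rw [← aztecIndicator_eq_one_iff, ← aztecIndicator_eq_one_iff]
  convert Iff.of_eq (congrArg (· = 1) key) using 3 <;> first | omega | (dsimp only [rowStart]; omega)

theorem IsChannel.mem_iff_colStart_mem {n : ℕ} {C : Set (AztecVertex n)}
    (hC : IsChannel (aztecDiamond n) C) {v : AztecVertex n} {i : Fin n}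
    (hi : v.1.1 + v.1.2 + n = 2 * (i : ℤ) + 2) : v ∈ C ↔ colStart i ∈ C := by
  rw [isChannel_aztecDiamond_iff] at hC
  have hv := aztec_bound_iff.1 v.2
  have key := eq_of_even_sum (n := n) (i := i) (j := ((v.1.1 - v.1.2 + n) / 2).toNat)
    (c := fun a b => aztecIndicator C ((a + b + 1) / 2 - n) ((b - a + 1) / 2))
    (fun a b => aztecIndicator_le_one C _ _)
    (fun a => aztecIndicator_eq_zero C (by omega))
    (fun i j hi hj => by
      convert hC (j + i + 1 - n) (i - j) (by omega) using 1
      rw [add_right_comm]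
      congr 4 <;> omega)
    i.2 (by omega)
  rw [← aztecIndicator_eq_one_iff, ← aztecIndicator_eq_one_iff]
  convert Iff.of_eq (congrArg (· = 1) key) using 3 <;> first | omega | (dsimp only [colStart]; omega)

/-- Channels of the Aztec diamond correspond to pairs of sets of rows. -/
def channelEquiv (n : ℕ) :
    {C : Set (AztecVertex n) // IsChannel (aztecDiamond n) C} ≃ Set (Fin n) × Set (Fin n) where
  toFun C := ({i | rowStart i ∈ C.1}, {i | colStart i ∈ C.1})
  invFun p := ⟨channelOfRows n p.1 p.2, isChannel_channelOfRows p.1 p.2⟩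
  left_inv C := by
    refine Subtype.ext (Set.ext fun v => ?_)
    have hv := aztec_bound_iff.1 v.2
    change ((∃ i : Fin n, rowStart i ∈ C.1 ∧ _) ∨ ∃ i : Fin n, colStart i ∈ C.1 ∧ _) ↔ v ∈ C.1
    constructor
    · rintro (⟨i, hi, h⟩ | ⟨i, hi, h⟩)
      · exact (C.2.mem_iff_rowStart_mem h).2 hi
      · exact (C.2.mem_iff_colStart_mem h).2 hi
    · intro h
      rcases Int.emod_two_eq_zero_or_one (v.1.1 - v.1.2 + n) with h0 | h1
      · obtain ⟨i, hi⟩ : ∃ i : Fin n, v.1.1 + v.1.2 + n = 2 * (i : ℤ) + 2 :=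
          ⟨⟨((v.1.1 + v.1.2 + n - 2) / 2).toNat, by omega⟩, by dsimp only; omega⟩
        exact Or.inr ⟨i, (C.2.mem_iff_colStart_mem hi).1 h, hi⟩
      · obtain ⟨i, hi⟩ : ∃ i : Fin n, v.1.1 - v.1.2 + n = 2 * (i : ℤ) + 1 :=
          ⟨⟨((v.1.1 - v.1.2 + n) / 2).toNat, by omega⟩, by dsimp only; omega⟩
        exact Or.inl ⟨i, (C.2.mem_iff_rowStart_mem hi).1 h, hi⟩
  right_inv p := by
    refine Prod.ext (Set.ext fun i => ?_) (Set.ext fun i => ?_)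
    · change ((∃ j ∈ p.1, (i : ℤ) + 1 - n - -i + n = 2 * (j : ℤ) + 1) ∨
        ∃ j ∈ p.2, (i : ℤ) + 1 - n + -i + n = 2 * (j : ℤ) + 2) ↔ i ∈ p.1
      constructor
      · rintro (⟨j, hj, h⟩ | ⟨j, hj, h⟩)
        · rwa [show i = j from Fin.ext (by omega)]
        · omega
      · exact fun h => Or.inl ⟨i, h, by ring⟩
    · change ((∃ j ∈ p.1, (i : ℤ) + 1 - n - (i + 1) + n = 2 * (j : ℤ) + 1) ∨
        ∃ j ∈ p.2, (i : ℤ) + 1 - n + (i + 1) + n = 2 * (j : ℤ) + 2) ↔ i ∈ p.2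
      constructor
      · rintro (⟨j, hj, h⟩ | ⟨j, hj, h⟩)
        · omega
        · rwa [show i = j from Fin.ext (by omega)]
      · exact fun h => Or.inr ⟨i, h, by ring⟩

/-- The Aztec diamond of rank `n` has exactly `2^{2n}` channels; consequently `2ⁿ` divides
its number of perfect matchings. -/
theorem aztecDiamond_channel_count (n : ℕ) (hn : 1 ≤ n) :
    Nat.card {C : Set {p : ℤ × ℤ // |2 * p.1 - 1| + |2 * p.2 - 1| ≤ 2 * (n : ℤ)} //
        IsChannel (aztecDiamond n) C} = 2 ^ (2 * n) ∧
    2 ^ n ∣ matchCount (aztecDiamond n) := by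
  constructor
  · rw [Nat.card_congr (channelEquiv n), Nat.card_prod, two_mul, pow_add]
    simp
  · have : NeZero n := ⟨by omega⟩
    simpa using (aztecCells n).two_pow_dvd_matchCount (aztecCells_exists_doubled n)
end

section
/- The complete bipartite graph K_{3,3} has exactly 6 perfect matchings, and exactly 4 channels consisting only of vertices from one fixed side of the bipartition; in particular, 2² = 4 does not divide m_{K_{3,3}} = 6, so the divisibility conclusion of the Channeling 2s theorem fails for graphs without a Kasteleyn signing. -/
section CompleteBipartite

variable {α β : Type*}

/-- The subgraph of the complete bipartite graph formed by the edges joining `a` to `e a`. -/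
def Equiv.toBipartiteSubgraph (e : α ≃ β) : (completeBipartiteGraph α β).Subgraph where
  verts := _root_.Set.univ
  Adj
    | .inl a, .inr b => e a = b
    | .inr b, .inl a => e a = b
    | _, _ => False
  adj_sub {x y} h := by
    rcases x with a | b <;> rcases y with a' | b' <;> simp_all
  edge_vert _ := trivial
  symm := ⟨fun x y h => by rcases x with a | b <;> rcases y with a' | b' <;> exact h⟩

theorem Equiv.toBipartiteSubgraph_isPerfectMatching (e : α ≃ β) :
    e.toBipartiteSubgraph.IsPerfectMatching := by
  rw [SimpleGraph.Subgraph.isPerfectMatching_iff]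
  rintro (a | b)
  · refine ⟨.inr (e a), rfl, ?_⟩
    rintro (a' | b') h
    · exact h.elim
    · exact congrArg Sum.inr (Eq.symm h)
  · refine ⟨.inl (e.symm b), e.apply_symm_apply b, ?_⟩
    rintro (a' | b') h
    · exact congrArg Sum.inl (e.eq_symm_apply.2 h)
    · exact h.elim

theorem Equiv.toBipartiteSubgraph_injective :
    Function.Injective (Equiv.toBipartiteSubgraph : α ≃ β → _) := by
  intro e f h
  ext a
  have hadj : e.toBipartiteSubgraph.Adj (.inl a) (.inr (e a)) := rfl
  rw [h] at hadj
  exact Eq.symm hadj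

theorem SimpleGraph.Subgraph.IsPerfectMatching.exists_equiv_toBipartiteSubgraph_eq
    {M : (completeBipartiteGraph α β).Subgraph} (hM : M.IsPerfectMatching) :
    ∃ e : α ≃ β, e.toBipartiteSubgraph = M := by
  have huniq := SimpleGraph.Subgraph.isPerfectMatching_iff.1 hM
  have hl : ∀ a, ∃ b, M.Adj (.inl a) (.inr b) := by
    intro a
    obtain ⟨a' | b, h, -⟩ := huniq (.inl a)
    · simpa using M.adj_sub h
    · exact ⟨b, h⟩
  have hr : ∀ b, ∃ a, M.Adj (.inr b) (.inl a) := by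
    intro b
    obtain ⟨a | b', h, -⟩ := huniq (.inr b)
    · exact ⟨a, h⟩
    · simpa using M.adj_sub h
  choose f hf using hl
  choose g hg using hr
  refine ⟨⟨f, g, fun a => Sum.inl_injective ((huniq _).unique (hg _) (hf a).symm),
    fun b => Sum.inr_injective ((huniq _).unique (hf _) (hg b).symm)⟩, ?_⟩
  have hiff : ∀ a b, f a = b ↔ M.Adj (.inl a) (.inr b) := fun a b =>
    ⟨fun h => h ▸ hf a, fun h => Sum.inr_injective ((huniq _).unique (hf a) h)⟩
  refine SimpleGraph.Subgraph.ext hM.2.verts_eq_univ.symm ?_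
  funext x y
  refine propext ?_
  rcases x with a | b <;> rcases y with a' | b'
  · exact ⟨False.elim, fun h => by simpa using M.adj_sub h⟩
  · exact hiff a b'
  · exact (hiff a' b).trans (M.adj_comm _ _)
  · exact ⟨False.elim, fun h => by simpa using M.adj_sub h⟩

theorem matchCount_completeBipartiteGraph :
    matchCount (completeBipartiteGraph α β) = Nat.card (α ≃ β) := by
  refine (Nat.card_eq_of_bijective
    (fun e : α ≃ β => (⟨e.toBipartiteSubgraph, e.toBipartiteSubgraph_isPerfectMatching⟩ :
      {M : (completeBipartiteGraph α β).Subgraph // M.IsPerfectMatching})) ⟨?_, ?_⟩).symm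
  · exact fun e f h => Equiv.toBipartiteSubgraph_injective (congrArg Subtype.val h)
  · rintro ⟨M, hM⟩
    obtain ⟨e, he⟩ := hM.exists_equiv_toBipartiteSubgraph_eq
    exact ⟨e, Subtype.ext he⟩

theorem isChannel_completeBipartiteGraph_image_inl [Nonempty β] (s : Set α) :
    IsChannel (completeBipartiteGraph α β) (Sum.inl '' s) ↔ Even s.ncard := by
  have hr : ∀ b : β, {w | w ∈ (Sum.inl '' s : Set (α ⊕ β)) ∧
      (completeBipartiteGraph α β).Adj (.inr b) w} = Sum.inl '' s := by
    intro b
    ext (a | b') <;> simp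
  have hl : ∀ a : α, {w | w ∈ (Sum.inl '' s : Set (α ⊕ β)) ∧
      (completeBipartiteGraph α β).Adj (.inl a) w} = ∅ := by
    intro a
    ext (a' | b) <;> simp
  simp only [IsChannel, Sum.forall, hl, hr, Set.ncard_image_of_injective s Sum.inl_injective,
    Set.ncard_empty, Even.zero, implies_true, true_and, forall_const]

theorem card_left_channels_completeBipartiteGraph [Fintype α] [Nonempty β] :
    Nat.card {C : Set (α ⊕ β) //
        IsChannel (completeBipartiteGraph α β) C ∧ ∀ v ∈ C, v.isLeft = true} =
      Nat.card {s : Finset α // Even s.card} := by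
  refine (Nat.card_eq_of_bijective (fun s : {s : Finset α // Even s.card} =>
    (⟨Sum.inl '' (s.1 : Set α), (isChannel_completeBipartiteGraph_image_inl _).2
        (by simpa using s.2), by simp⟩ : {C : Set (α ⊕ β) //
      IsChannel (completeBipartiteGraph α β) C ∧ ∀ v ∈ C, v.isLeft = true})) ⟨?_, ?_⟩).symm
  · intro s t h
    exact Subtype.ext (Finset.coe_injective
      (Sum.inl_injective.image_injective (congrArg Subtype.val h)))
  · rintro ⟨C, hC, hleft⟩
    classical
    obtain ⟨s, rfl⟩ : ∃ s : Finset α, Sum.inl '' (s : Set α) = C := by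
      refine ⟨(Sum.inl ⁻¹' C).toFinset, ?_⟩
      rw [Set.coe_toFinset, Set.image_preimage_eq_iff]
      intro v hv
      obtain ⟨a, rfl⟩ := Sum.isLeft_iff.1 (hleft v hv)
      exact ⟨a, rfl⟩
    exact ⟨⟨s, by simpa using (isChannel_completeBipartiteGraph_image_inl _).1 hC⟩, rfl⟩

end CompleteBipartite

/-- `K_{3,3}` has exactly 6 perfect matchings and exactly 4 channels consisting only of
vertices from one fixed side of the bipartition; in particular `2² = 4` does not divide
`m_{K_{3,3}} = 6`, so the Channeling 2s conclusion fails without a Kasteleyn signing. -/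
theorem K33_counterexample :
    matchCount (completeBipartiteGraph (Fin 3) (Fin 3)) = 6 ∧
    Nat.card {C : Set (Fin 3 ⊕ Fin 3) //
        IsChannel (completeBipartiteGraph (Fin 3) (Fin 3)) C ∧
          ∀ v ∈ C, v.isLeft = true} = 4 ∧
    ¬ (2 ^ 2 ∣ matchCount (completeBipartiteGraph (Fin 3) (Fin 3))) := by
  have hmatch : matchCount (completeBipartiteGraph (Fin 3) (Fin 3)) = 6 := by
    rw [matchCount_completeBipartiteGraph, Nat.card_eq_fintype_card]
    decide
  refine ⟨hmatch, ?_, by rw [hmatch]; decide⟩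
  rw [card_left_channels_completeBipartiteGraph, Nat.card_eq_fintype_card]
  decide
end
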